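/- arXiv:1706.08468 — 5 statements merged into one kernel-verified Lean document; each statement's English description precedes it below -/
import Mathlib

section
/- There exists a constant c > 0 with the following property: for every natural number n ≥ 1, every natural number k ≤ n, and every real ε with 0 < ε < 1, setting D = ⌈c·n/ε²⌉, there exists a function g : {0,1}^n × Fin D → {0,1}^k such that for every k' ≤ k, the k'-prefix graph of the bipartite graph given by g is a (k', ε)-extractor. -/
open Finset

/-- The bipartite graph given by `g` (left set `{0,1}^n`, right set `{0,1}^m`, edge labels
`Y`, left degree `D = |Y|`) is a `(k, ε)`-extractor: for every `B ⊆ L` with `|B| ≥ 2 ^ k`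
and every `A ⊆ R`, `| e(B,A) / (|B| * D) - |A| / 2 ^ m | ≤ ε`, where `e(B, A)` is the
number of pairs `(x, y) ∈ B × Y` with `g (x, y) ∈ A`. -/
def IsExtractor {n m : ℕ} {Y : Type*} [Fintype Y]
    (g : (Fin n → Bool) × Y → (Fin m → Bool)) (k : ℕ) (ε : ℝ) : Prop :=
  ∀ B : Finset (Fin n → Bool), 2 ^ k ≤ B.card →
    ∀ A : Finset (Fin m → Bool),
      |(((B ×ˢ (univ : Finset Y)).filter (fun p => g p ∈ A)).card : ℝ) /
          ((B.card : ℝ) * (Fintype.card Y : ℝ)) - (A.card : ℝ) / (2 ^ m : ℝ)| ≤ ε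


/-- Moment generating function bound for a random function. -/
lemma mgf_bound {X R : Type} [Fintype X] [DecidableEq X] [Fintype R]
    (T : Finset X) (φ : R → ℝ) (h0 : ∑ r, φ r = 0) (h1 : ∀ r, |φ r| ≤ 1)
    (l : ℝ) (hl : |l| ≤ 1) :
    ∑ g : X → R, Real.exp (l * ∑ p ∈ T, φ (g p)) ≤
      (Fintype.card (X → R) : ℝ) * Real.exp (l ^ 2 * T.card) := by
  classical
  have key : ∑ r, Real.exp (l * φ r) ≤ (Fintype.card R : ℝ) * Real.exp (l ^ 2) := by
    have hb : ∀ r, Real.exp (l * φ r) ≤ 1 + l ^ 2 + l * φ r := by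
      intro r
      have ha : |l * φ r| ≤ 1 := by
        rw [abs_mul]
        exact mul_le_one₀ hl (abs_nonneg _) (h1 r)
      have hh := (abs_le.mp (Real.abs_exp_sub_one_sub_id_le ha)).2
      have h2 : (φ r) ^ 2 ≤ 1 := by
        have := h1 r
        rw [← sq_abs]
        exact pow_le_one₀ (abs_nonneg _) this
      have h3 : (l * φ r) ^ 2 ≤ l ^ 2 := by
        rw [mul_pow]
        exact mul_le_of_le_one_right (sq_nonneg _) h2
      linarith
    calc ∑ r, Real.exp (l * φ r) ≤ ∑ r, (1 + l ^ 2 + l * φ r) :=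
          Finset.sum_le_sum fun r _ => hb r
      _ = (Fintype.card R : ℝ) * (1 + l ^ 2) := by
          rw [Finset.sum_add_distrib, ← Finset.mul_sum, h0]
          simp [mul_add]
      _ ≤ _ := by
          have := Real.add_one_le_exp (l ^ 2)
          gcongr
          linarith
  have e1 : ∀ g : X → R, Real.exp (l * ∑ p ∈ T, φ (g p)) =
      ∏ p, (if p ∈ T then Real.exp (l * φ (g p)) else 1) := by
    intro g
    rw [Finset.mul_sum, Real.exp_sum, Finset.prod_ite_mem, Finset.univ_inter]
  have e2 : ∑ g : X → R, ∏ p, (if p ∈ T then Real.exp (l * φ (g p)) else 1) =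
      ∏ p : X, ∑ r : R, (if p ∈ T then Real.exp (l * φ r) else 1) := by
    rw [Finset.prod_univ_sum, Fintype.piFinset_univ]
  simp_rw [e1]
  rw [e2]
  calc ∏ p : X, ∑ r : R, (if p ∈ T then Real.exp (l * φ r) else 1)
      ≤ ∏ p : X, ((Fintype.card R : ℝ) * (if p ∈ T then Real.exp (l ^ 2) else 1)) := by
        apply Finset.prod_le_prod
        · intro p _
          apply Finset.sum_nonneg
          intro r _
          split_ifs <;> positivity
        · intro p _
          by_cases hp : p ∈ T
          · simpa [hp] using key
          · simp [hp]
    _ = _ := by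
        rw [Finset.prod_mul_distrib, Finset.prod_ite_mem, Finset.univ_inter]
        simp only [Finset.prod_const, Finset.card_univ, Fintype.card_fun, Nat.cast_pow]
        rw [← Real.exp_nat_mul, mul_comm (T.card : ℝ)]

/-- Prefix balance. -/
lemma prefix_sum (k k' : ℕ) (h : k' ≤ k) (A : Finset (Fin k' → Bool)) :
    ∑ r : Fin k → Bool, ((if (fun i : Fin k' => r (Fin.castLE h i)) ∈ A then (1 : ℝ) else 0)
      - (A.card : ℝ) / 2 ^ k') = 0 := by
  obtain ⟨d, rfl⟩ := Nat.exists_eq_add_of_le h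
  rw [← (Fin.appendEquiv (α := Bool) k' d).sum_comp, Fintype.sum_prod_type_right]
  have : ∀ (a : Fin k' → Bool) (b : Fin d → Bool),
      (fun i : Fin k' => (Fin.appendEquiv k' d (a, b)) (Fin.castLE h i)) = a := by
    intro a b
    funext i
    exact Fin.append_left a b i
  simp only [this]
  apply Finset.sum_eq_zero
  intro b _
  rw [Finset.sum_sub_distrib]
  simp
  field_simp
  simp

lemma union_bound (n k : ℕ) (hn : 1 ≤ n) (hk : k ≤ n) :
    ∑ k' : Fin (k + 1), ∑ B : Finset (Fin n → Bool) with 2 ^ (k' : ℕ) ≤ B.card,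
      ∑ _A : Finset (Fin (k' : ℕ) → Bool), 2 * Real.exp (-(5 * n * B.card)) < 1 := by
  have he : Real.exp (-5) ≤ 1 / 32 := by
    rw [Real.exp_neg, inv_eq_one_div]
    apply one_div_le_one_div_of_le (by norm_num)
    have h2 : (2 : ℝ) ≤ Real.exp 1 := by
      have := Real.add_one_le_exp 1
      linarith
    calc (32 : ℝ) = 2 ^ 5 := by norm_num
      _ ≤ (Real.exp 1) ^ 5 := by gcongr
      _ = Real.exp 5 := by rw [← Real.exp_nat_mul]; norm_num
  have hexp : ∀ b : ℕ, Real.exp (-(5 * n * b)) ≤ ((1 / 32 : ℝ) ^ n) ^ b := by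
    intro b
    calc Real.exp (-(5 * n * b)) = ((Real.exp (-5)) ^ n) ^ b := by
          rw [← pow_mul, ← Real.exp_nat_mul]
          congr 1
          push_cast
          ring
      _ ≤ _ := by gcongr
  have hn2 : ((n : ℝ) + 1) ≤ 2 ^ n := by
    exact_mod_cast (Nat.lt_two_pow_self (n := n))
  have h2n : (2 : ℝ) ≤ 2 ^ n := by
    calc (2 : ℝ) = 2 ^ 1 := by norm_num
      _ ≤ 2 ^ n := pow_le_pow_right₀ (by norm_num) hn
  set q : ℝ := (1 / 4) ^ n with hq
  have hq0 : 0 < q := by positivity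
  have hterm : ∀ b : ℕ, 1 ≤ b →
      ((n : ℝ) + 1) * (2 ^ b * (2 * Real.exp (-(5 * n * b)))) ≤ q ^ b := by
    intro b hb
    have hb2 : ∀ x : ℝ, 1 ≤ x → x ≤ x ^ b := fun x hx => by
      calc x = x ^ 1 := by ring
        _ ≤ x ^ b := pow_le_pow_right₀ hx hb
    calc ((n : ℝ) + 1) * (2 ^ b * (2 * Real.exp (-(5 * n * b))))
        ≤ (2 ^ n) ^ b * ((2 ^ n) ^ b * ((2 ^ n) ^ b * ((1 / 32 : ℝ) ^ n) ^ b)) := by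
          gcongr
          · exact hn2.trans (hb2 _ (by linarith))
          · exact h2n.trans (hb2 _ (by linarith))
          · exact hexp b
      _ = q ^ b := by
          rw [hq, ← mul_pow, ← mul_pow, ← mul_pow, ← mul_pow, ← mul_pow, ← mul_pow]
          norm_num
  have hsum : ∑ B : Finset (Fin n → Bool), q ^ B.card = (1 + q) ^ (2 ^ n) := by
    have := Finset.sum_pow_mul_eq_add_pow q 1 (Finset.univ : Finset (Fin n → Bool))
    simp only [one_pow, mul_one, Finset.powerset_univ, Finset.card_univ, Fintype.card_fun,
      Fintype.card_bool, Fintype.card_fin] at this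
    rw [this, add_comm]
  have hlt : (1 + q) ^ (2 ^ n) < 2 := by
    have hN : ((2 ^ n : ℕ) : ℝ) * q ≤ 1 / 2 := by
      push_cast
      rw [hq, ← mul_pow]
      norm_num
      calc (1 / 2 : ℝ) ^ n ≤ (1 / 2) ^ 1 := pow_le_pow_of_le_one (by norm_num) (by norm_num) hn
        _ = 1 / 2 := by norm_num
    have hhalf : Real.exp (1 / 2) < 2 := by
      have h1 : Real.exp (1 / 2) ^ 2 = Real.exp 1 := by
        rw [← Real.exp_nat_mul]; norm_num
      have h3 := Real.exp_one_lt_d9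
      have h4 := Real.exp_pos (1 / 2)
      nlinarith
    calc (1 + q) ^ (2 ^ n) ≤ (Real.exp q) ^ (2 ^ n) := by
          have := Real.add_one_le_exp q
          gcongr
          linarith
      _ = Real.exp (((2 ^ n : ℕ) : ℝ) * q) := by rw [← Real.exp_nat_mul]
      _ ≤ Real.exp (1 / 2) := Real.exp_le_exp.mpr hN
      _ < 2 := hhalf
  have hne : ∑ B : Finset (Fin n → Bool) with 1 ≤ B.card, q ^ B.card < 1 := by
    have hs := Finset.sum_filter_add_sum_filter_not (Finset.univ : Finset (Finset (Fin n → Bool)))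
      (fun B => 1 ≤ B.card) (fun B => q ^ B.card)
    have h1 : (1 : ℝ) ≤ ∑ B : Finset (Fin n → Bool) with ¬ 1 ≤ B.card, q ^ B.card := by
      have := Finset.single_le_sum (s := Finset.univ.filter
        (fun B : Finset (Fin n → Bool) => ¬ 1 ≤ B.card)) (f := fun B => q ^ B.card)
        (fun B _ => by positivity) (a := ∅) (by simp)
      simpa using this
    linarith
  have hinner : ∀ k' : Fin (k + 1),
      ∑ B : Finset (Fin n → Bool) with 2 ^ (k' : ℕ) ≤ B.card,
      ∑ _A : Finset (Fin (k' : ℕ) → Bool), 2 * Real.exp (-(5 * n * B.card)) ≤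
      ∑ B : Finset (Fin n → Bool) with 1 ≤ B.card, q ^ B.card / (n + 1) := by
    intro k'
    calc _ ≤ ∑ B : Finset (Fin n → Bool) with 2 ^ (k' : ℕ) ≤ B.card, q ^ B.card / (n + 1) := by
          apply Finset.sum_le_sum
          intro B hB
          have hB' : 2 ^ (k' : ℕ) ≤ B.card := by simpa using hB
          rw [le_div_iff₀ (by positivity), mul_comm]
          refine le_trans ?_ (hterm B.card (Nat.one_le_two_pow.trans hB'))
          gcongr
          rw [Finset.sum_const, nsmul_eq_mul]
          gcongr
          simp only [Finset.card_univ, Fintype.card_finset, Fintype.card_fun, Fintype.card_bool,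
            Fintype.card_fin, Nat.cast_pow, Nat.cast_ofNat]
          exact pow_le_pow_right₀ (by norm_num) hB'
      _ ≤ _ := by
          apply Finset.sum_le_sum_of_subset_of_nonneg
          · intro B hB
            simp only [Finset.mem_filter, Finset.mem_univ, true_and] at hB ⊢
            exact Nat.one_le_two_pow.trans hB
          · intro B _ _
            positivity
  calc _ ≤ ∑ _k' : Fin (k + 1),
        ∑ B : Finset (Fin n → Bool) with 1 ≤ B.card, q ^ B.card / (n + 1) :=
        Finset.sum_le_sum fun k' _ => hinner k'
    _ = ((k : ℝ) + 1) / (n + 1) *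
        ∑ B : Finset (Fin n → Bool) with 1 ≤ B.card, q ^ B.card := by
        rw [Finset.sum_const, ← Finset.sum_div]
        simp
        ring
    _ ≤ 1 * ∑ B : Finset (Fin n → Bool) with 1 ≤ B.card, q ^ B.card := by
        gcongr
        rw [div_le_one (by positivity)]
        gcongr
    _ < 1 := by simpa using hne

theorem stmt1 :
    ∃ c : ℝ, 0 < c ∧
      ∀ n : ℕ, 1 ≤ n → ∀ k : ℕ, k ≤ n → ∀ ε : ℝ, 0 < ε → ε < 1 →
        ∃ g : (Fin n → Bool) × Fin (⌈c * (n : ℝ) / ε ^ 2⌉₊) → (Fin k → Bool),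
          ∀ k' : ℕ, ∀ h : k' ≤ k,
            IsExtractor (fun p => fun i : Fin k' => g p (Fin.castLE h i)) k' ε := by
  refine ⟨20, by norm_num, ?_⟩
  intro n hn k hk ε hε hε1
  have hD : 20 * (n : ℝ) / ε ^ 2 ≤ (⌈20 * (n : ℝ) / ε ^ 2⌉₊ : ℝ) := Nat.le_ceil _
  generalize ⌈20 * (n : ℝ) / ε ^ 2⌉₊ = D at hD ⊢
  have hn0 : (0 : ℝ) < n := by exact_mod_cast hn
  have hDpos : (0 : ℝ) < D := lt_of_lt_of_le (by positivity) hD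
  have hDε : 20 * (n : ℝ) ≤ D * ε ^ 2 := by
    rwa [div_le_iff₀ (by positivity)] at hD
  let φ : (k' : Fin (k + 1)) → Finset (Fin (k' : ℕ) → Bool) → (Fin k → Bool) → ℝ :=
    fun k' A r => (if (fun i : Fin (k' : ℕ) => r (Fin.castLE (Nat.lt_succ_iff.mp k'.2) i)) ∈ A
      then (1 : ℝ) else 0) - (A.card : ℝ) / 2 ^ (k' : ℕ)
  have hφ0 : ∀ k' A, ∑ r, φ k' A r = 0 := fun k' A => prefix_sum k k' _ A
  have hφ1 : ∀ k' A r, |φ k' A r| ≤ 1 := by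
    intro k' A r
    have ha : (A.card : ℝ) / 2 ^ (k' : ℕ) ≤ 1 := by
      rw [div_le_one (by positivity)]
      have := Finset.card_le_univ A
      simp only [Fintype.card_fun, Fintype.card_bool, Fintype.card_fin] at this
      exact_mod_cast this
    have hb : 0 ≤ (A.card : ℝ) / 2 ^ (k' : ℕ) := by positivity
    simp only [φ]
    rw [abs_le]
    split_ifs <;> constructor <;> linarith
  let T : Finset (Fin n → Bool) → Finset ((Fin n → Bool) × Fin D) := fun B => B ×ˢ Finset.univ
  have hT : ∀ B, ((T B).card : ℝ) = B.card * D := by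
    intro B
    simp [T, Finset.card_product]
  let W : (k' : Fin (k + 1)) → Finset (Fin n → Bool) → Finset (Fin (k' : ℕ) → Bool) →
      ((Fin n → Bool) × Fin D → (Fin k → Bool)) → ℝ :=
    fun k' B A g =>
      (Real.exp ((ε / 2) * ∑ p ∈ T B, φ k' A (g p)) +
        Real.exp ((-(ε / 2)) * ∑ p ∈ T B, φ k' A (g p))) *
        Real.exp (-(ε ^ 2 / 2 * (B.card * D)))
  have hW0 : ∀ k' B A g, 0 ≤ W k' B A g := fun k' B A g => by positivity
  set M : ℝ := (Fintype.card ((Fin n → Bool) × Fin D → (Fin k → Bool)) : ℝ) with hM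
  have hMpos : 0 < M := by
    rw [hM]
    exact_mod_cast Fintype.card_pos
  have hW : ∀ k' B A, ∑ g, W k' B A g ≤ M * (2 * Real.exp (-(5 * n * B.card))) := by
    intro k' B A
    have hl : |ε / 2| ≤ 1 := by
      rw [abs_of_pos (by positivity)]
      linarith
    have m1 := mgf_bound (T B) (φ k' A) (hφ0 k' A) (hφ1 k' A) (ε / 2) hl
    have m2 := mgf_bound (T B) (φ k' A) (hφ0 k' A) (hφ1 k' A) (-(ε / 2)) (by rwa [abs_neg])
    rw [neg_sq] at m2
    simp only [W]
    rw [← Finset.sum_mul, Finset.sum_add_distrib]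
    calc _ ≤ (M * Real.exp ((ε / 2) ^ 2 * (T B).card) + M * Real.exp ((ε / 2) ^ 2 * (T B).card))
          * Real.exp (-(ε ^ 2 / 2 * (B.card * D))) := by
          gcongr
      _ = M * (2 * Real.exp (-(ε ^ 2 / 4 * (B.card * D)))) := by
          have : Real.exp (-(ε ^ 2 / 4 * (B.card * D))) = Real.exp ((ε / 2) ^ 2 * (T B).card) *
              Real.exp (-(ε ^ 2 / 2 * (B.card * D))) := by
            rw [← Real.exp_add, hT]
            congr 1
            ring
          rw [this]
          ring
      _ ≤ _ := by
          have hb : (0 : ℝ) ≤ B.card := by positivity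
          have hh : 5 * n * (B.card : ℝ) ≤ ε ^ 2 / 4 * (B.card * D) := by nlinarith
          have := Real.exp_le_exp.mpr (neg_le_neg hh)
          gcongr M * (2 * ?_)
  have htot : ∑ g, ∑ k' : Fin (k + 1), ∑ B : Finset (Fin n → Bool) with 2 ^ (k' : ℕ) ≤ B.card,
      ∑ A : Finset (Fin (k' : ℕ) → Bool), W k' B A g <
      ∑ _g : (Fin n → Bool) × Fin D → (Fin k → Bool), (1 : ℝ) := by
    rw [Finset.sum_comm]
    calc _ ≤ ∑ k' : Fin (k + 1), ∑ B : Finset (Fin n → Bool) with 2 ^ (k' : ℕ) ≤ B.card,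
          ∑ _A : Finset (Fin (k' : ℕ) → Bool), M * (2 * Real.exp (-(5 * n * B.card))) := by
          apply Finset.sum_le_sum
          intro k' _
          rw [Finset.sum_comm]
          apply Finset.sum_le_sum
          intro B _
          rw [Finset.sum_comm]
          apply Finset.sum_le_sum
          intro A _
          exact hW k' B A
      _ = M * ∑ k' : Fin (k + 1), ∑ B : Finset (Fin n → Bool) with 2 ^ (k' : ℕ) ≤ B.card,
          ∑ _A : Finset (Fin (k' : ℕ) → Bool), 2 * Real.exp (-(5 * n * B.card)) := by
          simp_rw [Finset.mul_sum]
      _ < M * 1 := mul_lt_mul_of_pos_left (union_bound n k hn hk) hMpos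
      _ = _ := by
          rw [Finset.sum_const, Finset.card_univ, nsmul_eq_mul]
  obtain ⟨g, -, hg⟩ := Finset.exists_lt_of_sum_lt htot
  refine ⟨g, ?_⟩
  intro k0 h B hB A
  let k' : Fin (k + 1) := ⟨k0, Nat.lt_succ_of_le h⟩
  have hlt : W k' B A g < 1 := by
    refine lt_of_le_of_lt ?_ hg
    calc W k' B A g ≤ ∑ A : Finset (Fin (k' : ℕ) → Bool), W k' B A g :=
          Finset.single_le_sum (f := fun A => W k' B A g) (fun A _ => hW0 k' B A g)
            (Finset.mem_univ A)
      _ ≤ ∑ B : Finset (Fin n → Bool) with 2 ^ (k' : ℕ) ≤ B.card,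
          ∑ A : Finset (Fin (k' : ℕ) → Bool), W k' B A g :=
          Finset.single_le_sum (f := fun B => ∑ A : Finset (Fin (k' : ℕ) → Bool), W k' B A g)
            (fun B _ => Finset.sum_nonneg fun A _ => hW0 k' B A g)
            (by simpa using hB)
      _ ≤ _ :=
          Finset.single_le_sum (f := fun k' : Fin (k + 1) =>
            ∑ B : Finset (Fin n → Bool) with 2 ^ (k' : ℕ) ≤ B.card,
            ∑ A : Finset (Fin (k' : ℕ) → Bool), W k' B A g)
            (fun k' _ => Finset.sum_nonneg fun B _ => Finset.sum_nonneg fun A _ => hW0 k' B A g)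
            (Finset.mem_univ k')
  have hBpos : (0 : ℝ) < B.card := by
    exact_mod_cast lt_of_lt_of_le (Nat.two_pow_pos k0) hB
  have hS : ∑ p ∈ T B, φ k' A (g p) =
      (((B ×ˢ (Finset.univ : Finset (Fin D))).filter
        (fun p => (fun i : Fin k0 => g p (Fin.castLE h i)) ∈ A)).card : ℝ) -
        B.card * D * ((A.card : ℝ) / 2 ^ k0) := by
    simp only [φ]
    rw [Finset.sum_sub_distrib, Finset.sum_const, nsmul_eq_mul, hT, Finset.sum_boole]
  simp only [W] at hlt
  rw [hS] at hlt
  rw [Fintype.card_fin]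
  generalize (((B ×ˢ (Finset.univ : Finset (Fin D))).filter
        (fun p => (fun i : Fin k0 => g p (Fin.castLE h i)) ∈ A)).card : ℝ) = E at hlt ⊢
  rw [add_mul, ← Real.exp_add, ← Real.exp_add] at hlt
  have u1 := Real.exp_lt_one_iff.mp (lt_of_le_of_lt (le_add_of_nonneg_right (Real.exp_pos _).le) hlt)
  have u2 := Real.exp_lt_one_iff.mp (lt_of_le_of_lt (le_add_of_nonneg_left (Real.exp_pos _).le) hlt)
  generalize (A.card : ℝ) / 2 ^ k0 = a at *
  have hN : (0 : ℝ) < B.card * D := by positivity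
  generalize (B.card : ℝ) * D = N at *
  have v1 : E - N * a < ε * N := by
    by_contra hc
    push Not at hc
    nlinarith
  have v2 : -(E - N * a) < ε * N := by
    by_contra hc
    push Not at hc
    nlinarith
  have : E / N - a = (E - N * a) / N := by
    field_simp
  rw [this, abs_le]
  constructor
  · rw [le_div_iff₀ hN]
    linarith
  · rw [div_le_iff₀ hN]
    linarith
end

section
/- Let g : {0,1}^n × Y → {0,1}^m define a bipartite graph G with left degree D = |Y| that is a (k,ε)-extractor, where 0 < ε ≤ 1/2, and set δ = √(2ε). Then for every B ⊆ {0,1}^n with |B| > 2^k, the number of x ∈ B for which fewer than (1−δ)·D labels y ∈ Y satisfy that the B-degree of g(x,y) is at most (2/δ²)·|B|·D/2^m is at most δ·|B|. (In words: in any set B in the large regime, all but a δ fraction of the elements of B have at least a (1−δ) fraction of their neighbors of B-degree at most (2/δ²) times the average right B-degree.) -/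
open Finset

/-- The `B`-degree of a right node `z`: the number of pairs `(x, y) ∈ B × Y` with
`g (x, y) = z` (multi-edges allowed, edges labeled by `Y`). -/
def Bdeg {n : ℕ} {Y R : Type*} [Fintype Y] [DecidableEq R]
    (g : (Fin n → Bool) × Y → R) (B : Finset (Fin n → Bool)) (z : R) : ℕ :=
  ((B ×ˢ (univ : Finset Y)).filter (fun p => g p = z)).card

theorem stmt2 {n m : ℕ} {Y : Type*} [Fintype Y]
    (g : (Fin n → Bool) × Y → (Fin m → Bool)) (k : ℕ) (ε δ : ℝ)
    (hε0 : 0 < ε) (hε1 : ε ≤ 1 / 2) (hδ : δ = Real.sqrt (2 * ε))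
    (hg : IsExtractor g k ε)
    (B : Finset (Fin n → Bool)) (hB : 2 ^ k < B.card) :
    ((B.filter (fun x =>
        ((univ.filter (fun y : Y =>
            (Bdeg g B (g (x, y)) : ℝ) ≤
              (2 / δ ^ 2) * (B.card : ℝ) * (Fintype.card Y : ℝ) / (2 ^ m : ℝ))).card : ℝ) <
          (1 - δ) * (Fintype.card Y : ℝ))).card : ℝ) ≤ δ * (B.card : ℝ) := by
  classical
  have hδ0 : 0 < δ := by rw [hδ]; exact Real.sqrt_pos.mpr (by linarith)
  have hδ2 : δ ^ 2 = 2 * ε := by rw [hδ]; exact Real.sq_sqrt (by linarith)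
  have hb : (0 : ℝ) < (B.card : ℝ) := by
    exact_mod_cast lt_of_le_of_lt (Nat.zero_le _) hB
  rcases Nat.eq_zero_or_pos (Fintype.card Y) with hD | hD
  · have hempty : B.filter (fun x =>
        ((univ.filter (fun y : Y =>
            (Bdeg g B (g (x, y)) : ℝ) ≤
              (2 / δ ^ 2) * (B.card : ℝ) * (Fintype.card Y : ℝ) / (2 ^ m : ℝ))).card : ℝ) <
          (1 - δ) * (Fintype.card Y : ℝ)) = ∅ := by
      apply Finset.filter_eq_empty_iff.mpr
      intro x _
      rw [hD, not_lt, Nat.cast_zero, mul_zero]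
      exact Nat.cast_nonneg _
    rw [hempty]
    simp only [card_empty, Nat.cast_zero]
    positivity
  have hd : (0 : ℝ) < (Fintype.card Y : ℝ) := by exact_mod_cast hD
  have hM : (0 : ℝ) < (2 : ℝ) ^ m := by positivity
  set T : ℝ := (2 / δ ^ 2) * (B.card : ℝ) * (Fintype.card Y : ℝ) / (2 ^ m : ℝ) with hT
  set A : Finset (Fin m → Bool) := univ.filter (fun z => T < (Bdeg g B z : ℝ)) with hA
  set E : ℕ := ((B ×ˢ (univ : Finset Y)).filter (fun p => g p ∈ A)).card with hE
  have hext := hg B hB.le A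
  have hE1 : (E : ℝ) ≤ (B.card : ℝ) * (Fintype.card Y : ℝ) := by
    have : E ≤ (B ×ˢ (univ : Finset Y)).card := card_filter_le _ _
    rw [card_product, card_univ] at this
    exact_mod_cast this
  have hE2 : (A.card : ℝ) * T ≤ (E : ℝ) := by
    have h1 : E = ∑ z ∈ A, Bdeg g B z := by
      rw [hE, card_eq_sum_card_fiberwise (f := g) (t := A)]
      · apply sum_congr rfl
        intro z hz
        unfold Bdeg
        congr 1
        ext p
        simp only [mem_filter]
        constructor
        · rintro ⟨⟨h, _⟩, h'⟩
          exact ⟨h, h'⟩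
        · rintro ⟨h, h'⟩
          exact ⟨⟨h, h' ▸ hz⟩, h'⟩
      · intro p hp
        have hp' := Finset.mem_coe.mp hp
        exact (mem_filter.mp hp').2
    rw [h1, Nat.cast_sum, ← nsmul_eq_mul]
    apply card_nsmul_le_sum
    intro z hz
    exact (mem_filter.mp hz).2.le
  have hE3 : (E : ℝ) = ∑ x ∈ B, ((univ.filter (fun y : Y => g (x, y) ∈ A)).card : ℝ) := by
    rw [hE, card_filter, sum_product, Nat.cast_sum]
    apply sum_congr rfl
    intro x _
    rw [card_filter]
  have hp : (E : ℝ) ≤ δ ^ 2 * ((B.card : ℝ) * (Fintype.card Y : ℝ)) := by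
    have hbd := mul_pos hb hd
    have h1 := (abs_le.mp hext).2
    have h2 : (A.card : ℝ) / 2 ^ m ≤ ε := by
      have h3 : (A.card : ℝ) * T = ((A.card : ℝ) / 2 ^ m) / ε *
          ((B.card : ℝ) * (Fintype.card Y : ℝ)) := by
        rw [hT, hδ2]; field_simp
      have h4 : ((A.card : ℝ) / 2 ^ m) / ε ≤ 1 := by
        by_contra hc
        push Not at hc
        nlinarith
      rwa [div_le_one hε0] at h4
    rw [hδ2, ← div_le_iff₀ hbd]
    linarith
  set S := B.filter (fun x =>
        ((univ.filter (fun y : Y => (Bdeg g B (g (x, y)) : ℝ) ≤ T)).card : ℝ) <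
          (1 - δ) * (Fintype.card Y : ℝ)) with hS
  have hS1 : (S.card : ℝ) * (δ * (Fintype.card Y : ℝ)) ≤ (E : ℝ) := by
    rw [hE3, ← nsmul_eq_mul]
    refine le_trans (card_nsmul_le_sum S
      (fun x => ((univ.filter (fun y : Y => g (x, y) ∈ A)).card : ℝ)) _ ?_)
      (sum_le_sum_of_subset_of_nonneg (filter_subset _ _) (fun _ _ _ => Nat.cast_nonneg _))
    intro x hx
    have hx2 := (mem_filter.mp hx).2
    have hc := card_filter_add_card_filter_not (s := (univ : Finset Y))
      (fun y : Y => (Bdeg g B (g (x, y)) : ℝ) ≤ T)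
    have he : univ.filter (fun y : Y => ¬ (Bdeg g B (g (x, y)) : ℝ) ≤ T) =
        univ.filter (fun y : Y => g (x, y) ∈ A) := by
      ext y
      simp [hA]
    rw [he, card_univ] at hc
    have hc' : ((univ.filter (fun y : Y => (Bdeg g B (g (x, y)) : ℝ) ≤ T)).card : ℝ) +
        ((univ.filter (fun y : Y => g (x, y) ∈ A)).card : ℝ) = (Fintype.card Y : ℝ) := by
      exact_mod_cast hc
    show δ * (Fintype.card Y : ℝ) ≤ ((univ.filter (fun y : Y => g (x, y) ∈ A)).card : ℝ)
    linarith
  have hpos : 0 < δ * (Fintype.card Y : ℝ) := mul_pos hδ0 hd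
  refine le_of_mul_le_mul_right ?_ hpos
  calc _ ≤ (E : ℝ) := hS1
    _ ≤ _ := hp
    _ = _ := by ring
end

section
/- Let u₁, u₂, …, u_s be natural numbers less than 2^n with u_j ≠ u₁ for all j ∈ {2,…,s}, let ε be a real number with 0 < ε < 1, let t be a natural number with t ≥ s·n/ε, and let p₁ < p₂ < ⋯ < p_t be the first t prime numbers. Then the number of indices i ∈ {1,…,t} for which there exists some j ∈ {2,…,s} with u₁ ≡ u_j (mod p_i) is at most ε·t. (Consequently, if i is chosen uniformly at random from {1,…,t} and h(u) = (p_i, u mod p_i), then with probability at least 1−ε the hash value h(u₁) differs from each of h(u₂), …, h(u_s).) -/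
open Finset

lemma aux_card (n t d : ℕ) (hd : d ≠ 0) (hdn : d < 2 ^ n) :
    (univ.filter (fun i : Fin t => Nat.nth Nat.Prime (i : ℕ) ∣ d)).card ≤ n := by
  have h1 : (univ.filter (fun i : Fin t => Nat.nth Nat.Prime (i : ℕ) ∣ d)).card
      ≤ d.primeFactors.card := by
    apply Finset.card_le_card_of_injOn (fun i : Fin t => Nat.nth Nat.Prime (i : ℕ))
    · intro i hi
      have hi' : Nat.nth Nat.Prime (i : ℕ) ∣ d := by simpa using hi
      exact Finset.mem_coe.2 (Nat.mem_primeFactors.2 ⟨Nat.prime_nth_prime _, hi', hd⟩)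
    · intro a _ b _ hab
      exact Fin.ext (Nat.nth_injective Nat.infinite_setOfPred_prime hab)
  have h2 : 2 ^ d.primeFactors.card ≤ ∏ p ∈ d.primeFactors, p :=
    Finset.pow_card_le_prod _ _ _ (fun p hp => (Nat.prime_of_mem_primeFactors hp).two_le)
  have h3 := Nat.le_of_dvd (Nat.pos_of_ne_zero hd) (Nat.prod_primeFactors_dvd d)
  have h4 : 2 ^ d.primeFactors.card < 2 ^ n := by omega
  have h5 := (Nat.pow_lt_pow_iff_right (by norm_num : 1 < 2)).1 h4
  omega

theorem stmt5 (n s t : ℕ) (hs : 1 ≤ s) (u : Fin s → ℕ) (hu : ∀ i, u i < 2 ^ n)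
    (hne : ∀ j : Fin s, j ≠ ⟨0, hs⟩ → u j ≠ u ⟨0, hs⟩)
    (ε : ℝ) (hε0 : 0 < ε) (hε1 : ε < 1) (ht : ((s : ℝ) * (n : ℝ)) / ε ≤ (t : ℝ)) :
    ((univ.filter (fun i : Fin t => ∃ j : Fin s, j ≠ ⟨0, hs⟩ ∧
        u ⟨0, hs⟩ ≡ u j [MOD Nat.nth Nat.Prime (i : ℕ)])).card : ℝ) ≤ ε * (t : ℝ) := by
  have key : (univ.filter (fun i : Fin t => ∃ j : Fin s, j ≠ ⟨0, hs⟩ ∧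
        u ⟨0, hs⟩ ≡ u j [MOD Nat.nth Nat.Prime (i : ℕ)])).card ≤ s * n := by
    have hsub : (univ.filter (fun i : Fin t => ∃ j : Fin s, j ≠ ⟨0, hs⟩ ∧
        u ⟨0, hs⟩ ≡ u j [MOD Nat.nth Nat.Prime (i : ℕ)])) ⊆
        (univ.filter (fun j : Fin s => j ≠ ⟨0, hs⟩)).biUnion (fun j =>
          univ.filter (fun i : Fin t => Nat.nth Nat.Prime (i : ℕ) ∣
            ((u j : ℤ) - (u ⟨0, hs⟩ : ℤ)).natAbs)) := by
      intro i hi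
      obtain ⟨j, hj, hm⟩ := (Finset.mem_filter.1 hi).2
      refine Finset.mem_biUnion.2 ⟨j, by simpa using hj, ?_⟩
      refine Finset.mem_filter.2 ⟨Finset.mem_univ _, ?_⟩
      exact Int.natCast_dvd.1 (Nat.modEq_iff_dvd.1 hm)
    refine (Finset.card_le_card hsub).trans ((Finset.card_biUnion_le_card_mul _ _ n ?_).trans ?_)
    · intro j hj
      have hj' := hne j (Finset.mem_filter.1 hj).2
      have h1 := hu j
      have h2 := hu ⟨0, hs⟩
      apply aux_card
      · omega
      · generalize 2 ^ n = N at *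
        omega
    · apply Nat.mul_le_mul_right
      simpa using Finset.card_le_univ (univ.filter (fun j : Fin s => j ≠ ⟨0, hs⟩))
  have h2 : (s : ℝ) * n ≤ t * ε := (div_le_iff₀ hε0).1 ht
  have h3 : ((univ.filter (fun i : Fin t => ∃ j : Fin s, j ≠ ⟨0, hs⟩ ∧
        u ⟨0, hs⟩ ≡ u j [MOD Nat.nth Nat.Prime (i : ℕ)])).card : ℝ) ≤ s * n := by
    exact_mod_cast key
  linarith
end

section
/- There exists a constant c > 0 with the following property: for every natural number n ≥ 1, every natural number k ≤ n, and every real ε with 0 < ε < 1, if D ≥ c·n/ε², then for a function f : {0,1}^n × Fin D → {0,1}^k chosen uniformly at random, with probability greater than 3/4 the following holds: for every k' ≤ k, the k'-prefix graph of the bipartite graph given by f is a (k', ε)-extractor. -/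
open Finset

open Classical in
/-- Chernoff-type tail bound, by counting. -/
lemma tail_count {P V : Type*} [Fintype P] [DecidableEq P] [Fintype V]
    (g : V → ℝ) (hg0 : ∑ v, g v = 0) (hg1 : ∀ v, |g v| ≤ 1) (S : Finset P)
    (ε : ℝ) (h0 : 0 < ε) (h1 : ε < 1) :
    ((univ.filter (fun f : P → V => ε * (S.card : ℝ) < ∑ p ∈ S, g (f p))).card : ℝ) ≤
      (Fintype.card (P → V) : ℝ) * Real.exp (-(ε ^ 2 * S.card / 4)) := by
  have hfac : ∀ p : P, ∑ v : V, Real.exp (if p ∈ S then ε / 2 * g v else 0) ≤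
      (Fintype.card V : ℝ) * Real.exp (if p ∈ S then ε ^ 2 / 4 else 0) := by
    intro p
    by_cases hp : p ∈ S
    · simp only [hp, if_true]
      have hb : ∀ v, Real.exp (ε / 2 * g v) ≤ 1 + ε / 2 * g v + ε ^ 2 / 4 := by
        intro v
        have hgv := abs_le.1 (hg1 v)
        have hx : |ε / 2 * g v| ≤ 1 := by
          rw [abs_mul, abs_of_pos (by linarith : 0 < ε / 2)]
          nlinarith [hg1 v, abs_nonneg (g v)]
        have h2 := (abs_le.1 (Real.abs_exp_sub_one_sub_id_le hx)).2
        have h3 : (g v) ^ 2 ≤ 1 := by nlinarith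
        nlinarith [sq_nonneg ε]
      calc ∑ v : V, Real.exp (ε / 2 * g v) ≤ ∑ v : V, (1 + ε / 2 * g v + ε ^ 2 / 4) :=
            Finset.sum_le_sum fun v _ => hb v
        _ = (Fintype.card V : ℝ) * (ε ^ 2 / 4 + 1) := by
            rw [Finset.sum_add_distrib, Finset.sum_add_distrib, ← Finset.mul_sum, hg0]
            simp; ring
        _ ≤ _ := by
            gcongr
            exact Real.add_one_le_exp _
    · simp [hp]
  have hmgf : ∑ f : P → V, Real.exp (ε / 2 * ∑ p ∈ S, g (f p)) ≤
      (Fintype.card (P → V) : ℝ) * Real.exp (ε ^ 2 / 4 * S.card) := by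
    calc ∑ f : P → V, Real.exp (ε / 2 * ∑ p ∈ S, g (f p))
        = ∑ f : P → V, ∏ p, Real.exp (if p ∈ S then ε / 2 * g (f p) else 0) := by
          refine Finset.sum_congr rfl fun f _ => ?_
          rw [← Real.exp_sum, Finset.mul_sum]
          congr 1
          simp [Finset.sum_ite_mem]
      _ = ∏ p : P, ∑ v : V, Real.exp (if p ∈ S then ε / 2 * g v else 0) := by
          rw [Fintype.prod_sum]
      _ ≤ ∏ p : P, ((Fintype.card V : ℝ) * Real.exp (if p ∈ S then ε ^ 2 / 4 else 0)) :=
          Finset.prod_le_prod (fun p _ => Finset.sum_nonneg fun v _ => (Real.exp_pos _).le)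
            fun p _ => hfac p
      _ = _ := by
          rw [Finset.prod_mul_distrib, ← Real.exp_sum]
          simp [Finset.sum_ite_mem]
          left
          ring
  have hm : ((univ.filter (fun f : P → V => ε * (S.card : ℝ) < ∑ p ∈ S, g (f p))).card : ℝ) *
      Real.exp (ε ^ 2 / 2 * S.card) ≤ ∑ f : P → V, Real.exp (ε / 2 * ∑ p ∈ S, g (f p)) := by
    rw [← nsmul_eq_mul, ← Finset.sum_const]
    refine (Finset.sum_le_sum fun f hf => ?_).trans
      (Finset.sum_le_sum_of_subset_of_nonneg (Finset.filter_subset _ _)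
        fun f _ _ => (Real.exp_pos _).le)
    rw [Finset.mem_filter] at hf
    apply Real.exp_le_exp.2
    nlinarith [hf.2]
  have := hm.trans hmgf
  rw [← le_div_iff₀ (Real.exp_pos _), mul_div_assoc, ← Real.exp_sub] at this
  have he : -(ε ^ 2 * (S.card : ℝ) / 4) = ε ^ 2 / 4 * S.card - ε ^ 2 / 2 * S.card := by ring
  rw [he]
  exact this

lemma initial_bits_count {k k' : ℕ} (h : k' ≤ k) (A : Finset (Fin k' → Bool)) :
    ∑ v : Fin k → Bool,
      ((if (fun i : Fin k' => v (Fin.castLE h i)) ∈ A then (1 : ℝ) else 0) -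
        (A.card : ℝ) / 2 ^ k') = 0 := by
  obtain ⟨r, rfl⟩ := Nat.exists_eq_add_of_le h
  rw [← (Fin.appendEquiv k' r (α := Bool)).sum_comp, Fintype.sum_prod_type]
  have : ∀ (a : Fin k' → Bool) (b : Fin r → Bool),
      (fun i : Fin k' => (Fin.appendEquiv k' r) (a, b) (Fin.castLE h i)) = a := by
    intro a b
    funext i
    exact Fin.append_left a b i
  simp only [this]
  simp [Finset.sum_sub_distrib]
  field_simp
  simp

open Classical in
lemma bad_count {n k D k' : ℕ} (h : k' ≤ k) (ε : ℝ) (h0 : 0 < ε) (h1 : ε < 1) (hD : 0 < D)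
    (B : Finset (Fin n → Bool)) (hB : 0 < B.card) (A : Finset (Fin k' → Bool)) :
    ((univ.filter (fun f : (Fin n → Bool) × Fin D → (Fin k → Bool) =>
      ¬ |(((B ×ˢ (univ : Finset (Fin D))).filter
          (fun p => (fun i : Fin k' => f p (Fin.castLE h i)) ∈ A)).card : ℝ) /
          ((B.card : ℝ) * (Fintype.card (Fin D) : ℝ)) - (A.card : ℝ) / (2 ^ k' : ℝ)| ≤ ε)).card : ℝ)
      ≤ (Fintype.card ((Fin n → Bool) × Fin D → (Fin k → Bool)) : ℝ) *
        (2 * Real.exp (-(ε ^ 2 * (B.card * D) / 4))) := by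
  set g : (Fin k → Bool) → ℝ := fun v =>
    (if (fun i : Fin k' => v (Fin.castLE h i)) ∈ A then (1 : ℝ) else 0) -
        (A.card : ℝ) / 2 ^ k' with hg
  have hg0 : ∑ v, g v = 0 := initial_bits_count h A
  have hA1 : (A.card : ℝ) / 2 ^ k' ≤ 1 := by
    rw [div_le_one (by positivity)]
    have := Finset.card_le_univ A
    simp at this
    exact_mod_cast this
  have hA0 : 0 ≤ (A.card : ℝ) / 2 ^ k' := by positivity
  have hg1 : ∀ v, |g v| ≤ 1 := by
    intro v
    rw [abs_le]
    simp only [hg]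
    split_ifs <;> constructor <;> linarith
  have t1 := tail_count (P := (Fin n → Bool) × Fin D) g hg0 hg1 (B ×ˢ univ) ε h0 h1
  have t2 := tail_count (P := (Fin n → Bool) × Fin D) (fun v => - g v) (by simp [hg0])
    (by simpa using hg1) (B ×ˢ univ) ε h0 h1
  have hS : (((B ×ˢ (univ : Finset (Fin D))).card : ℕ) : ℝ) = B.card * D := by
    simp
  rw [hS] at t1 t2
  have hpos : (0 : ℝ) < B.card * D := by positivity
  refine le_trans ?_ ((add_le_add t1 t2).trans (by linarith))
  rw [← Nat.cast_add]
  refine Nat.cast_le.2 (le_trans (Finset.card_le_card ?_) (Finset.card_union_le _ _))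
  intro f hf
  rw [Finset.mem_filter] at hf
  rw [Finset.mem_union, Finset.mem_filter, Finset.mem_filter]
  have hsum : ∑ p ∈ B ×ˢ (univ : Finset (Fin D)), g (f p) =
      (((B ×ˢ (univ : Finset (Fin D))).filter
          (fun p => (fun i : Fin k' => f p (Fin.castLE h i)) ∈ A)).card : ℝ) -
        (B.card * D) * ((A.card : ℝ) / 2 ^ k') := by
    simp only [hg]
    rw [Finset.sum_sub_distrib, Finset.sum_const, nsmul_eq_mul, hS, Finset.sum_boole]
  rw [Finset.sum_neg_distrib, hsum]
  have hh := hf.2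
  rw [not_le, lt_abs, Fintype.card_fin] at hh
  rcases hh with hh | hh
  · left
    refine ⟨mem_univ _, ?_⟩
    rw [lt_sub_iff_add_lt, lt_div_iff₀ hpos] at hh
    linarith
  · right
    refine ⟨mem_univ _, ?_⟩
    rw [neg_sub, lt_sub_comm, div_lt_iff₀ hpos] at hh
    linarith

lemma sum_subsets (n : ℕ) (hn : 1 ≤ n) :
    ∑ B ∈ (univ : Finset (Finset (Fin n → Bool))).erase ∅,
      (2 * Real.exp (-(8 * n : ℝ))) ^ B.card ≤ 2 * (2 ^ n * (2 * Real.exp (-(8 * n : ℝ)))) ∧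
    (n + 1 : ℝ) * (2 * (2 * (2 ^ n * (2 * Real.exp (-(8 * n : ℝ)))))) < 1 / 4 := by
  have he : Real.exp (-(8 * n : ℝ)) ≤ (1 / 256) ^ n := by
    have h1 : Real.exp (-(8 * n : ℝ)) = (Real.exp (-1)) ^ (8 * n) := by
      rw [← Real.exp_nat_mul]; congr 1; push_cast; ring
    have h2 : Real.exp (-1) ≤ 1 / 2 := by
      rw [Real.exp_neg, ← one_div]
      apply one_div_le_one_div_of_le (by norm_num)
      have := Real.add_one_le_exp (1 : ℝ)
      linarith
    rw [h1, pow_mul]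
    have h3 : Real.exp (-1) ^ 8 ≤ (1 / 2 : ℝ) ^ 8 := by gcongr
    have h4 : (1 / 2 : ℝ) ^ 8 = 1 / 256 := by norm_num
    rw [h4] at h3
    gcongr
  have hN : (n + 1 : ℝ) ≤ 2 ^ n := by exact_mod_cast Nat.lt_two_pow_self (n := n)
  have hp : (2 : ℝ) ^ n * (1 / 256) ^ n = (1 / 128) ^ n := by
    rw [← mul_pow]; norm_num
  have hp2 : (2 : ℝ) ^ n * (1 / 128) ^ n = (1 / 64) ^ n := by
    rw [← mul_pow]; norm_num
  have hq : (1 / 128 : ℝ) ^ n ≤ 1 / 128 := pow_le_of_le_one (by norm_num) (by norm_num) (by omega)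
  have hq2 : (1 / 64 : ℝ) ^ n ≤ 1 / 64 := pow_le_of_le_one (by norm_num) (by norm_num) (by omega)
  have hz : (2 : ℝ) ^ n * Real.exp (-(8 * n : ℝ)) ≤ (1 / 128) ^ n := by
    rw [← hp]; gcongr
  have hz0 : 0 < (2 : ℝ) ^ n * Real.exp (-(8 * n : ℝ)) := by positivity
  constructor
  · set y := 2 * Real.exp (-(8 * n : ℝ)) with hy
    have hy0 : 0 ≤ y := by positivity
    have hall : ∑ B : Finset (Fin n → Bool), y ^ B.card = (y + 1) ^ (2 ^ n) := by
      have := Fintype.sum_pow_mul_eq_add_pow (Fin n → Bool) y 1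
      simpa using this
    have herase := Finset.add_sum_erase (univ : Finset (Finset (Fin n → Bool)))
      (fun B => y ^ B.card) (mem_univ ∅)
    simp only [Finset.card_empty, pow_zero] at herase
    have hexp : (y + 1) ^ (2 ^ n) ≤ Real.exp (2 ^ n * y) := by
      calc (y + 1) ^ (2 ^ n) ≤ (Real.exp y) ^ (2 ^ n) := by
            gcongr; exact Real.add_one_le_exp y
        _ = _ := by rw [← Real.exp_nat_mul]; push_cast; rfl
    have hw : 2 ^ n * y ≤ 1 := by rw [hy]; linarith
    have hw0 : 0 ≤ 2 ^ n * y := by positivity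
    have := (abs_le.1 (Real.abs_exp_sub_one_sub_id_le (abs_le.2 ⟨by linarith, hw⟩))).2
    nlinarith
  · have h5 : (n + 1 : ℝ) * (2 ^ n * Real.exp (-(8 * n : ℝ))) ≤ 2 ^ n * (1 / 128) ^ n := by
      gcongr
    rw [hp2] at h5
    linarith

open Classical in
theorem stmt7 :
    ∃ c : ℝ, 0 < c ∧
      ∀ n k : ℕ, 1 ≤ n → k ≤ n → ∀ ε : ℝ, 0 < ε → ε < 1 →
        ∀ D : ℕ, c * (n : ℝ) / ε ^ 2 ≤ (D : ℝ) →
          (3 / 4 : ℝ) <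
            ((univ.filter (fun f : (Fin n → Bool) × Fin D → (Fin k → Bool) =>
                ∀ k' : ℕ, ∀ h : k' ≤ k,
                  IsExtractor (fun p => fun i : Fin k' => f p (Fin.castLE h i)) k' ε)).card : ℝ) /
              (Fintype.card ((Fin n → Bool) × Fin D → (Fin k → Bool)) : ℝ) := by
  refine ⟨32, by norm_num, ?_⟩
  intro n k hn hk ε h0 h1 D hD
  have hn' : (1 : ℝ) ≤ n := by exact_mod_cast hn
  have hDpos : 0 < D := by
    have : (0 : ℝ) < 32 * n / ε ^ 2 := by positivity
    exact_mod_cast this.trans_le hD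
  have hD2 : 32 * (n : ℝ) ≤ ε ^ 2 * D := by
    rw [div_le_iff₀ (by positivity)] at hD
    linarith
  set F := (Fin n → Bool) × Fin D → (Fin k → Bool) with hF
  set N : ℝ := (Fintype.card F : ℝ) with hNdef
  have hNpos : 0 < N := by
    rw [hNdef]; exact_mod_cast Fintype.card_pos
  set good : F → Prop := fun f => ∀ k' : ℕ, ∀ h : k' ≤ k,
    IsExtractor (fun p => fun i : Fin k' => f p (Fin.castLE h i)) k' ε with hgood
  set bad : (j : Fin (k + 1)) → Finset (Fin n → Bool) → Finset (Fin j → Bool) → Finset F :=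
    fun j B A => univ.filter (fun f : F =>
      ¬ |(((B ×ˢ (univ : Finset (Fin D))).filter
          (fun p => (fun i : Fin j => f p (Fin.castLE (Nat.lt_succ_iff.1 j.2) i)) ∈ A)).card : ℝ) /
          ((B.card : ℝ) * (Fintype.card (Fin D) : ℝ)) - (A.card : ℝ) / (2 ^ (j : ℕ) : ℝ)| ≤ ε)
    with hbad
  have hsub : univ.filter (fun f => ¬ good f) ⊆
      (univ : Finset (Fin (k + 1))).biUnion fun j =>
        (univ.filter (fun B : Finset (Fin n → Bool) => 2 ^ (j : ℕ) ≤ B.card)).biUnion fun B =>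
          (univ : Finset (Finset (Fin j → Bool))).biUnion fun A => bad j B A := by
    intro f hf
    rw [Finset.mem_filter] at hf
    have hf2 := hf.2
    simp only [hgood, IsExtractor, not_forall] at hf2
    obtain ⟨k', h, B, hB, A, hA⟩ := hf2
    simp only [Finset.mem_biUnion]
    refine ⟨⟨k', Nat.lt_succ_of_le h⟩, mem_univ _, B, ?_, A, mem_univ _, ?_⟩
    · simpa using hB
    · simp only [hbad, Finset.mem_filter]
      refine ⟨mem_univ _, ?_⟩
      convert hA
  have hcount : ((univ.filter (fun f => ¬ good f)).card : ℝ) ≤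
      ∑ j : Fin (k + 1), ∑ B ∈ univ.filter (fun B : Finset (Fin n → Bool) => 2 ^ (j : ℕ) ≤ B.card),
        ∑ A : Finset (Fin j → Bool), ((bad j B A).card : ℝ) := by
    have := (Finset.card_le_card hsub).trans (Finset.card_biUnion_le.trans
      (Finset.sum_le_sum fun j _ => Finset.card_biUnion_le.trans
        (Finset.sum_le_sum fun B _ => Finset.card_biUnion_le)))
    exact_mod_cast this
  obtain ⟨hs1, hs2⟩ := sum_subsets n hn
  have hinner : ∀ j : Fin (k + 1),
      ∑ B ∈ univ.filter (fun B : Finset (Fin n → Bool) => 2 ^ (j : ℕ) ≤ B.card),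
        ∑ A : Finset (Fin j → Bool), ((bad j B A).card : ℝ) ≤
      N * (2 * (2 * (2 ^ n * (2 * Real.exp (-(8 * n : ℝ)))))) := by
    intro j
    have hB : ∀ B ∈ univ.filter (fun B : Finset (Fin n → Bool) => 2 ^ (j : ℕ) ≤ B.card),
        ∑ A : Finset (Fin j → Bool), ((bad j B A).card : ℝ) ≤
          N * 2 * (2 * Real.exp (-(8 * n : ℝ))) ^ B.card := by
      intro B hB
      have hB := (Finset.mem_filter.1 hB).2
      have hBpos : 0 < B.card := lt_of_lt_of_le (by positivity) hB
      have hA : ∀ A ∈ (univ : Finset (Finset (Fin j → Bool))), ((bad j B A).card : ℝ) ≤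
          N * (2 * Real.exp (-(8 * n : ℝ)) ^ B.card) := by
        intro A _
        have hb := bad_count (n := n) (D := D) (Nat.lt_succ_iff.1 j.2) ε h0 h1 hDpos B hBpos A
        refine le_trans (le_of_eq ?_) (hb.trans ?_)
        · simp only [hbad]
          congr!
        · rw [← Real.exp_nat_mul]
          gcongr
          nlinarith [(Nat.cast_nonneg B.card : (0 : ℝ) ≤ B.card)]
      refine (Finset.sum_le_sum hA).trans ?_
      rw [Finset.sum_const, nsmul_eq_mul, mul_pow]
      have hc : ((univ : Finset (Finset (Fin j → Bool))).card : ℝ) ≤ 2 ^ B.card := by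
        simp only [Finset.card_univ, Fintype.card_finset, Fintype.card_pi, Fintype.card_bool,
          Finset.prod_const, Fintype.card_fin, Nat.cast_pow, Nat.cast_ofNat]
        exact pow_le_pow_right₀ (by norm_num) hB
      calc _ ≤ (2 : ℝ) ^ B.card * (N * (2 * Real.exp (-(8 * n : ℝ)) ^ B.card)) := by gcongr
        _ = _ := by ring
    refine (Finset.sum_le_sum hB).trans ?_
    rw [← Finset.mul_sum, mul_assoc]
    gcongr
    refine le_trans (Finset.sum_le_sum_of_subset_of_nonneg ?_ fun _ _ _ => by positivity) hs1
    intro B hB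
    have hB := (Finset.mem_filter.1 hB).2
    rw [Finset.mem_erase]
    refine ⟨?_, mem_univ _⟩
    rintro rfl
    simp at hB
  have hfin : ((univ.filter (fun f => ¬ good f)).card : ℝ) < N * (1 / 4) := by
    refine (hcount.trans (Finset.sum_le_sum fun j _ => hinner j)).trans_lt ?_
    rw [Finset.sum_const, nsmul_eq_mul, Finset.card_univ, Fintype.card_fin]
    have hk' : ((k + 1 : ℕ) : ℝ) ≤ n + 1 := by exact_mod_cast Nat.succ_le_succ hk
    calc _ ≤ (n + 1 : ℝ) * (N * (2 * (2 * (2 ^ n * (2 * Real.exp (-(8 * n : ℝ))))))) := by gcongr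
      _ = N * ((n + 1 : ℝ) * (2 * (2 * (2 ^ n * (2 * Real.exp (-(8 * n : ℝ))))))) := by ring
      _ < _ := by gcongr
  have htot : ((univ.filter (fun f => good f)).card : ℝ) +
      ((univ.filter (fun f => ¬ good f)).card : ℝ) = N := by
    rw [hNdef, ← Finset.card_univ]
    exact_mod_cast Finset.card_filter_add_card_filter_not (s := univ) (p := good)
  rw [lt_div_iff₀ hNpos]
  linarith
end

section
/- (Slepian–Wolf theorem for a 3-DMS over bits.) Let p be a probability distribution on {0,1}×{0,1}×{0,1}, let (W_A, W_B, W_C) be distributed according to p, and for each n let (X_A, X_B, X_C) consist of n independent copies of (W_A, W_B, W_C), so that X_A, X_B, X_C are random n-bit strings (X_A being the sequence of first components of the n draws, X_B the second components, X_C the third components). Then for every real ε with 0 < ε < 1 there exists N such that for every n ≥ N and all natural numbers n_A, n_B, n_C satisfying, for every nonempty V ⊆ {A,B,C}, Σ_{i∈V} n_i ≥ n·( H(W_V | W_{V̄}) + ε ) — where V̄ = {A,B,C} \ V, W_V denotes the tuple of components of (W_A,W_B,W_C) with indices in V, and H(·|·) is conditional Shannon entropy measured in bits (with the convention H(W_V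 | W_∅) = H(W_V)) — there exist deterministic encoding functions E_A : {0,1}^n → {0,1}^{n_A}, E_B : {0,1}^n → {0,1}^{n_B}, E_C : {0,1}^n → {0,1}^{n_C} and a deterministic decoding function D : {0,1}^{n_A} × {0,1}^{n_B} × {0,1}^{n_C} → {0,1}^n × {0,1}^n × {0,1}^n such that Prob[ D(E_A(X_A), E_B(X_B), E_C(X_C)) = (X_A, X_B, X_C) ] ≥ 1 − ε. -/
open Finset

/-- The marginal probability, under the distribution `p` on triples of bits, of the event
that the components with indices in `V` agree with `a`. -/
def marg (p : (Fin 3 → Bool) → ℝ) (V : Finset (Fin 3)) (a : Fin 3 → Bool) : ℝ :=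
  ∑ b ∈ univ.filter (fun b : Fin 3 → Bool => ∀ i ∈ V, b i = a i), p b

/-- The conditional Shannon entropy `H(W_V ∣ W_V̄)` in bits, where `(W 0, W 1, W 2)` is
distributed according to `p`, `W_V` is the tuple of components with indices in `V` and
`V̄ = Vᶜ`: `H(W_V ∣ W_V̄) = ∑_w P(w) · log₂ (P(w restricted to V̄) / P(w))`.
(For `V = univ` this is the unconditional entropy `H(W_V)`.) -/
noncomputable def condEnt (p : (Fin 3 → Bool) → ℝ) (V : Finset (Fin 3)) : ℝ :=
  ∑ a : Fin 3 → Bool, p a * Real.logb 2 (marg p Vᶜ a / p a)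


lemma chern {α : Type} [Fintype α] [DecidableEq α] (p f : α → ℝ) (hp0 : ∀ a, 0 ≤ p a) (hp1 : ∑ a, p a = 1)
    (c : ℝ) (hc : ∑ a, p a * f a < c) :
    ∃ r : ℝ, 0 ≤ r ∧ r < 1 ∧ ∀ n : ℕ,
      ∑ x ∈ (univ : Finset (Fin n → α)).filter (fun x => (n : ℝ) * c ≤ ∑ t, f (x t)), ∏ t, p (x t) ≤ r ^ n := by
  let φ : ℝ → ℝ := fun l => ∑ a, p a * Real.exp (l * (f a - c))
  have hd : HasDerivAt φ (∑ a, p a * (f a - c)) 0 := by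
    have : ∀ a ∈ (univ : Finset α), HasDerivAt (fun l : ℝ => p a * Real.exp (l * (f a - c))) (p a * (f a - c)) 0 := by
      intro a _
      have h1 : HasDerivAt (fun l : ℝ => l * (f a - c)) (f a - c) 0 := by
        simpa using (hasDerivAt_id (0:ℝ)).mul_const (f a - c)
      have h2 := (h1.exp).const_mul (p a)
      simpa using h2
    exact HasDerivAt.fun_sum this
  have hneg : ∑ a, p a * (f a - c) < 0 := by
    simp only [mul_sub, sum_sub_distrib, ← sum_mul, hp1]; linarith
  have hφ0 : φ 0 = 1 := by simp [φ, hp1]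
  have hex : ∃ l : ℝ, 0 < l ∧ φ l < 1 := by
    have h1 := hd.hasDerivWithinAt (s := Set.Ioi 0)
    have h2 := (hasDerivWithinAt_iff_tendsto_slope' (by simp)).1 h1
    have h3 := h2.eventually (gt_mem_nhds hneg)
    obtain ⟨l, hl, hl0⟩ := (h3.and self_mem_nhdsWithin).exists
    refine ⟨l, hl0, ?_⟩
    have hl0 : 0 < l := hl0
    rw [slope_def_field, hφ0, sub_zero, div_lt_iff₀ hl0] at hl
    linarith
  obtain ⟨l, hl, hlt⟩ := hex
  refine ⟨φ l, sum_nonneg fun a _ => mul_nonneg (hp0 a) (Real.exp_pos _).le, hlt, fun n => ?_⟩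
  have e : φ l ^ n = ∑ x : Fin n → α, ∏ t, (p (x t) * Real.exp (l * (f (x t) - c))) := by
    rw [← Fintype.piFinset_univ, ← prod_univ_sum (fun _ => univ) (fun _ a => p a * Real.exp (l * (f a - c)))]
    simp [φ]
  rw [e]
  have hnn : ∀ x : Fin n → α, 0 ≤ ∏ t, p (x t) := fun x => prod_nonneg fun t _ => hp0 _
  calc _ ≤ ∑ x ∈ (univ : Finset (Fin n → α)).filter (fun x => (n : ℝ) * c ≤ ∑ t, f (x t)),
        ∏ t, (p (x t) * Real.exp (l * (f (x t) - c))) := by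
        refine sum_le_sum fun x hx => ?_
        rw [prod_mul_distrib, ← Real.exp_sum, ← mul_sum]
        refine le_mul_of_one_le_right (hnn x) (Real.one_le_exp (mul_nonneg hl.le ?_))
        have := (mem_filter.1 hx).2
        simp only [sum_sub_distrib, sum_const, card_univ, Fintype.card_fin, nsmul_eq_mul]
        linarith
    _ ≤ _ := sum_le_sum_of_subset_of_nonneg (filter_subset _ _) fun x _ _ =>
        prod_nonneg fun t _ => mul_nonneg (hp0 _) (Real.exp_pos _).le

lemma hash_card {α β : Type} [Fintype α] [DecidableEq α] [Fintype β] [DecidableEq β] {a b : α} (h : a ≠ b) :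
    (univ.filter fun f : α → β => f a = f b).card * Fintype.card β = Fintype.card (α → β) := by
  rw [← card_univ (α := β), ← card_product, ← card_univ]
  refine card_bij' (fun q _ => Function.update q.1 a q.2) (fun g _ => (Function.update g a (g b), g a)) ?_ ?_ ?_ ?_
  · intros; simp
  · intros; simp [h.symm]
  · rintro ⟨f, c⟩ hf
    simp only [mem_product, mem_filter, mem_univ, true_and, and_true] at hf
    simp [h.symm, ← hf]
  · intros; simp

abbrev Code (n : ℕ) (m : Fin 3 → ℕ) := ∀ i : Fin 3, (Fin n → Bool) → (Fin (m i) → Bool)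

def enc {n : ℕ} {m : Fin 3 → ℕ} (E : Code n m) (x : Fin n → Fin 3 → Bool) : ∀ i : Fin 3, Fin (m i) → Bool :=
  fun i => E i (fun t => x t i)

def diffSet {n : ℕ} (x y : Fin n → Fin 3 → Bool) : Finset (Fin 3) :=
  univ.filter fun i => (fun t => y t i) ≠ (fun t => x t i)

lemma coll_card {n : ℕ} {m : Fin 3 → ℕ} (x y : Fin n → Fin 3 → Bool) :
    (univ.filter fun E : Code n m => enc E y = enc E x).card * 2 ^ (∑ i ∈ diffSet x y, m i)
      = Fintype.card (Code n m) := by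
  have e : (univ.filter fun E : Code n m => enc E y = enc E x)
      = Fintype.piFinset (fun i => univ.filter fun f : (Fin n → Bool) → (Fin (m i) → Bool) =>
          f (fun t => y t i) = f (fun t => x t i)) := by
    ext E
    simp [enc, funext_iff]
  rw [e, Fintype.card_piFinset, Fintype.card_pi, ← prod_pow_eq_pow_sum, diffSet, prod_filter, ← prod_mul_distrib]
  refine prod_congr rfl fun i _ => ?_
  split_ifs with h
  · rw [← hash_card h]; simp
  · push Not at h
    rw [h]; simp [card_univ]

lemma marg_pos (p : (Fin 3 → Bool) → ℝ) (hp0 : ∀ w, 0 ≤ p w) (V : Finset (Fin 3)) (a) (ha : 0 < p a) :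
    0 < marg p V a := by
  refine lt_of_lt_of_le ha ?_
  exact single_le_sum (f := p) (fun b _ => hp0 b) (by simp)

lemma count (p : (Fin 3 → Bool) → ℝ) (hp0 : ∀ w, 0 ≤ p w) {n : ℕ} (c : ℝ) (V : Finset (Fin 3))
    (x : Fin n → Fin 3 → Bool) (S : Finset (Fin n → Fin 3 → Bool))
    (hS : ∀ y ∈ S, (∀ t, 0 < p (y t)) ∧ (∀ t, ∀ i ∈ Vᶜ, y t i = x t i) ∧
      ∑ t, Real.logb 2 (marg p Vᶜ (y t) / p (y t)) ≤ n * c) :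
    (S.card : ℝ) ≤ 2 ^ (n * c) := by
  have hm : ∀ a b : Fin 3 → Bool, (∀ i ∈ Vᶜ, b i = a i) → marg p Vᶜ b = marg p Vᶜ a := by
    intro a b h
    unfold marg
    congr 1
    ext w
    simp only [mem_filter, mem_univ, true_and]
    exact ⟨fun H i hi => (H i hi).trans (h i hi), fun H i hi => (H i hi).trans (h i hi).symm⟩
  have h1 : ∑ y ∈ S, ∏ t, (p (y t) / marg p Vᶜ (x t)) ≤ 1 := by
    calc _ ≤ ∑ y ∈ Fintype.piFinset (fun t => univ.filter fun b : Fin 3 → Bool => ∀ i ∈ Vᶜ, b i = x t i),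
          ∏ t, (p (y t) / marg p Vᶜ (x t)) := by
          refine sum_le_sum_of_subset_of_nonneg ?_ ?_
          · intro y hy
            simp only [Fintype.mem_piFinset, mem_filter, mem_univ, true_and]
            exact (hS y hy).2.1
          · exact fun y _ _ => prod_nonneg fun t _ => div_nonneg (hp0 _) (sum_nonneg fun b _ => hp0 b)
      _ = ∏ t, ∑ b ∈ univ.filter (fun b : Fin 3 → Bool => ∀ i ∈ Vᶜ, b i = x t i), p b / marg p Vᶜ (x t) := by
          rw [prod_univ_sum]
      _ ≤ 1 := by
          refine prod_le_one (fun t _ => sum_nonneg fun b _ => div_nonneg (hp0 _) (sum_nonneg fun b _ => hp0 b)) fun t _ => ?_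
          rw [← sum_div]
          exact div_self_le_one _
  have h2 : ∀ y ∈ S, (2 : ℝ) ^ (-(n * c)) ≤ ∏ t, (p (y t) / marg p Vᶜ (x t)) := by
    intro y hy
    obtain ⟨a1, a2, a3⟩ := hS y hy
    have : ∏ t, (p (y t) / marg p Vᶜ (x t)) = 2 ^ (-∑ t, Real.logb 2 (marg p Vᶜ (y t) / p (y t))) := by
      rw [← sum_neg_distrib, Real.rpow_sum_of_pos (by norm_num)]
      refine prod_congr rfl fun t _ => ?_
      have := marg_pos p hp0 Vᶜ (y t) (a1 t)
      rw [Real.rpow_neg (by norm_num), Real.rpow_logb (by norm_num) (by norm_num) (div_pos this (a1 t)), inv_div,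
        hm (x t) (y t) (a2 t)]
    rw [this]
    exact Real.rpow_le_rpow_of_exponent_le (by norm_num) (by linarith)
  have h3 := (card_nsmul_le_sum S _ _ h2).trans h1
  rw [nsmul_eq_mul, Real.rpow_neg (by norm_num), ← div_eq_mul_inv, div_le_one (by positivity)] at h3
  exact h3

lemma exists_code (p : (Fin 3 → Bool) → ℝ) (hp0 : ∀ w, 0 ≤ p w) (hp1 : ∑ w, p w = 1) {n : ℕ} (m : Fin 3 → ℕ)
    (ε : ℝ) (hm : ∀ V : Finset (Fin 3), V.Nonempty → (n : ℝ) * (condEnt p V + ε) ≤ ∑ i ∈ V, (m i : ℝ)) (η : Finset (Fin 3) → ℝ)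
    (hη : ∀ V, ∑ x ∈ (univ : Finset (Fin n → Fin 3 → Bool)).filter
      (fun x => (n : ℝ) * (condEnt p V + ε / 2) ≤ ∑ t, Real.logb 2 (marg p Vᶜ (x t) / p (x t))), ∏ t, p (x t) ≤ η V) :
    ∃ E : Code n m, ∃ D : (∀ i : Fin 3, Fin (m i) → Bool) → (Fin n → Fin 3 → Bool),
      1 - (∑ V, η V + 8 * 2 ^ (-(n * (ε / 2)))) ≤
        ∑ x ∈ univ.filter (fun x => D (enc E x) = x), ∏ t, p (x t) := by
  classical
  set T : Finset (Fin n → Fin 3 → Bool) := univ.filter fun x => (∀ t, 0 < p (x t)) ∧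
    ∀ V : Finset (Fin 3), ∑ t, Real.logb 2 (marg p Vᶜ (x t) / p (x t)) ≤ (n : ℝ) * (condEnt p V + ε / 2) with hT
  have hPnn : ∀ x : Fin n → Fin 3 → Bool, 0 ≤ ∏ t, p (x t) := fun x => prod_nonneg fun t _ => hp0 _
  have hPsum : ∑ x : Fin n → Fin 3 → Bool, ∏ t, p (x t) = 1 := by
    rw [← Fintype.piFinset_univ, ← prod_univ_sum (fun _ => univ) (fun _ a => p a)]
    simp [hp1]
  have hTc : ∑ x ∈ univ.filter (fun x => x ∉ T), ∏ t, p (x t) ≤ ∑ V, η V := by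
    calc _ ≤ ∑ x : Fin n → Fin 3 → Bool, ∑ V : Finset (Fin 3),
          if (n : ℝ) * (condEnt p V + ε / 2) ≤ ∑ t, Real.logb 2 (marg p Vᶜ (x t) / p (x t)) then ∏ t, p (x t) else 0 := by
          rw [sum_filter]
          refine sum_le_sum fun x _ => ?_
          have hnn : ∀ V ∈ (univ : Finset (Finset (Fin 3))), 0 ≤ if (n : ℝ) * (condEnt p V + ε / 2) ≤ ∑ t, Real.logb 2 (marg p Vᶜ (x t) / p (x t)) then ∏ t, p (x t) else 0 := by
            intro V _
            split_ifs
            · exact hPnn x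
            · exact le_rfl
          by_cases hx : x ∉ T
          · rw [if_pos hx]
            by_cases hpos : ∀ t, 0 < p (x t)
            · have : ∃ V : Finset (Fin 3), (n : ℝ) * (condEnt p V + ε / 2) < ∑ t, Real.logb 2 (marg p Vᶜ (x t) / p (x t)) := by
                by_contra! hcon
                exact hx (by rw [hT, mem_filter]; exact ⟨mem_univ _, hpos, hcon⟩)
              obtain ⟨V, hV⟩ := this
              refine le_trans ?_ (single_le_sum hnn (mem_univ V))
              rw [if_pos hV.le]
            · push Not at hpos
              obtain ⟨t, ht⟩ := hpos
              have : ∏ t, p (x t) = 0 := prod_eq_zero (mem_univ t) (le_antisymm ht (hp0 _))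
              simp [this]
          · rw [if_neg hx]
            exact sum_nonneg hnn
      _ ≤ _ := by
          rw [sum_comm]
          refine sum_le_sum fun V _ => ?_
          rw [← sum_filter]
          exact hη V
  let Bad : (Fin n → Fin 3 → Bool) → Code n m → Prop := fun x E => ∃ y ∈ T, y ≠ x ∧ enc E y = enc E x
  have hbad : ∀ x, ((univ.filter fun E => Bad x E).card : ℝ) ≤
      Fintype.card (Code n m) * (8 * 2 ^ (-(n * (ε / 2)))) := by
    intro x
    have h1 : (univ.filter fun E => Bad x E) ⊆
        (T.filter fun y => y ≠ x).biUnion fun y => univ.filter fun E : Code n m => enc E y = enc E x := by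
      intro E hE
      obtain ⟨y, hy, hne, he⟩ := (mem_filter.1 hE).2
      simp only [mem_biUnion, mem_filter, mem_univ, true_and]
      exact ⟨y, ⟨hy, hne⟩, he⟩
    have h2 := (card_le_card h1).trans card_biUnion_le
    have h3 : ((univ.filter fun E => Bad x E).card : ℝ) ≤ ∑ y ∈ T.filter (fun y => y ≠ x),
        (Fintype.card (Code n m) : ℝ) * 2 ^ (-∑ i ∈ diffSet x y, (m i : ℝ)) := by
      refine le_trans (Nat.cast_le.2 h2) ?_
      push_cast
      refine sum_le_sum fun y _ => ?_
      rw [← coll_card x y]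
      push_cast
      rw [Real.rpow_neg (by norm_num), mul_assoc, ← Real.rpow_natCast]
      push_cast
      rw [mul_inv_cancel₀ (by positivity), mul_one]
    refine h3.trans ?_
    rw [← mul_sum]
    refine mul_le_mul_of_nonneg_left ?_ (by positivity)
    rw [← sum_fiberwise _ (fun y => diffSet x y)]
    have h4 : ∀ V ∈ (univ : Finset (Finset (Fin 3))), ∑ y ∈ (T.filter (fun y => y ≠ x)).filter (fun y => diffSet x y = V),
        (2 : ℝ) ^ (-∑ i ∈ diffSet x y, (m i : ℝ)) ≤ 2 ^ (-(n * (ε / 2))) := by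
      intro V _
      rcases V.eq_empty_or_nonempty with rfl | hV
      · rw [sum_eq_zero]
        · positivity
        · intro y hy
          exfalso
          simp only [mem_filter] at hy
          apply hy.1.2
          have h5 := hy.2
          simp only [diffSet, filter_eq_empty_iff, mem_univ, true_imp_iff, not_not] at h5
          ext t i
          exact congrFun (h5 (x := i)) t
      · set S := (T.filter (fun y => y ≠ x)).filter (fun y => diffSet x y = V) with hS
        have hc := count p hp0 (condEnt p V + ε / 2) V x S (by
          intro y hy
          simp only [hS, hT, mem_filter, mem_univ, true_and] at hy
          obtain ⟨⟨⟨a1, a2⟩, a3⟩, a4⟩ := hy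
          refine ⟨a1, ?_, a2 V⟩
          intro t i hi
          rw [← a4] at hi
          simp only [diffSet, mem_compl, mem_filter, mem_univ, true_and, not_not] at hi
          exact congrFun hi t)
        have : ∑ y ∈ S, (2 : ℝ) ^ (-∑ i ∈ diffSet x y, (m i : ℝ)) = S.card * 2 ^ (-∑ i ∈ V, (m i : ℝ)) := by
          rw [← nsmul_eq_mul, ← sum_const]
          refine sum_congr rfl fun y hy => ?_
          rw [(mem_filter.1 hy).2]
        rw [this]
        refine (mul_le_mul_of_nonneg_right hc (by positivity)).trans ?_
        rw [← Real.rpow_add (by norm_num)]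
        refine Real.rpow_le_rpow_of_exponent_le (by norm_num) ?_
        have := hm V hV
        linarith
    refine (sum_le_sum h4).trans ?_
    simp
  have hE : ∃ E : Code n m, ∑ x ∈ univ.filter (fun x => Bad x E), ∏ t, p (x t) ≤ 8 * 2 ^ (-(n * (ε / 2))) := by
    have hh : ∑ E : Code n m, ∑ x ∈ univ.filter (fun x => Bad x E), ∏ t, p (x t)
        ≤ ∑ E : Code n m, (8 * 2 ^ (-(n * (ε / 2))) : ℝ) := by
      simp_rw [sum_filter]
      rw [sum_comm]
      calc _ = ∑ x : Fin n → Fin 3 → Bool, (∏ t, p (x t)) * ((univ.filter fun E => Bad x E).card : ℝ) := by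
            refine sum_congr rfl fun x _ => ?_
            rw [← sum_filter, sum_const, nsmul_eq_mul, mul_comm]
        _ ≤ ∑ x : Fin n → Fin 3 → Bool, (∏ t, p (x t)) * (Fintype.card (Code n m) * (8 * 2 ^ (-(n * (ε / 2))))) :=
            sum_le_sum fun x _ => mul_le_mul_of_nonneg_left (hbad x) (hPnn x)
        _ = _ := by
            rw [← sum_mul, hPsum, one_mul, sum_const, nsmul_eq_mul, card_univ]
    obtain ⟨E, _, h⟩ := exists_le_of_sum_le univ_nonempty hh
    exact ⟨E, h⟩
  obtain ⟨E, hE⟩ := hE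
  let D : (∀ i : Fin 3, Fin (m i) → Bool) → (Fin n → Fin 3 → Bool) := fun c =>
    if h : ∃ y ∈ T, enc E y = c then h.choose else fun _ _ => false
  have hD : ∀ x ∈ T, ¬ Bad x E → D (enc E x) = x := by
    intro x hx hb
    have h : ∃ y ∈ T, enc E y = enc E x := ⟨x, hx, rfl⟩
    have e : D (enc E x) = h.choose := dif_pos h
    rw [e]
    by_contra hne
    exact hb ⟨_, h.choose_spec.1, hne, h.choose_spec.2⟩
  refine ⟨E, D, ?_⟩
  have hsplit := sum_filter_add_sum_filter_not univ (fun x => D (enc E x) = x) (fun x => ∏ t, p (x t))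
  rw [hPsum] at hsplit
  have hle : ∑ x ∈ univ.filter (fun x => ¬ D (enc E x) = x), ∏ t, p (x t) ≤
      ∑ x ∈ univ.filter (fun x => x ∉ T), ∏ t, p (x t) + ∑ x ∈ univ.filter (fun x => Bad x E), ∏ t, p (x t) := by
    rw [sum_filter, sum_filter, sum_filter, ← sum_add_distrib]
    refine sum_le_sum fun x _ => ?_
    have := hPnn x
    have := hD x
    by_cases h1 : x ∈ T <;> by_cases h2 : Bad x E <;> by_cases h3 : D (enc E x) = x <;> simp_all
  linarith

theorem stmt9 (p : (Fin 3 → Bool) → ℝ) (hp0 : ∀ w, 0 ≤ p w) (hp1 : ∑ w, p w = 1)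
    (ε : ℝ) (hε0 : 0 < ε) (hε1 : ε < 1) :
    ∃ N : ℕ, ∀ n : ℕ, N ≤ n → ∀ nA nB nC : ℕ,
      (∀ V : Finset (Fin 3), V.Nonempty →
        (n : ℝ) * (condEnt p V + ε) ≤ ∑ i ∈ V, ((![nA, nB, nC] i : ℕ) : ℝ)) →
      ∃ EA : (Fin n → Bool) → (Fin nA → Bool),
      ∃ EB : (Fin n → Bool) → (Fin nB → Bool),
      ∃ EC : (Fin n → Bool) → (Fin nC → Bool),
      ∃ D : (Fin nA → Bool) × (Fin nB → Bool) × (Fin nC → Bool) →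
            (Fin n → Bool) × (Fin n → Bool) × (Fin n → Bool),
        1 - ε ≤
          ∑ x ∈ (univ : Finset ((Fin n → Bool) × (Fin n → Bool) × (Fin n → Bool))).filter
              (fun x => D (EA x.1, EB x.2.1, EC x.2.2) = x),
            ∏ i : Fin n, p ![x.1 i, x.2.1 i, x.2.2 i] := by
  have hch : ∀ V : Finset (Fin 3), ∃ r : ℝ, 0 ≤ r ∧ r < 1 ∧ ∀ n : ℕ,
      ∑ x ∈ (univ : Finset (Fin n → Fin 3 → Bool)).filter
        (fun x => (n : ℝ) * (condEnt p V + ε / 2) ≤ ∑ t, Real.logb 2 (marg p Vᶜ (x t) / p (x t))), ∏ t, p (x t)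
        ≤ r ^ n := by
    intro V
    refine chern p (fun a => Real.logb 2 (marg p Vᶜ a / p a)) hp0 hp1 _ ?_
    show condEnt p V < _
    linarith
  choose r hr0 hr1 hr using hch
  have hlim : Filter.Tendsto (fun n : ℕ => ∑ V, r V ^ n + 8 * (2 : ℝ) ^ (-(n * (ε / 2)))) Filter.atTop (nhds 0) := by
    have h1 : Filter.Tendsto (fun n : ℕ => ∑ V, r V ^ n) Filter.atTop (nhds 0) := by
      have := tendsto_finsetSum (univ : Finset (Finset (Fin 3)))
        (fun V _ => tendsto_pow_atTop_nhds_zero_of_lt_one (hr0 V) (hr1 V))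
      simpa using this
    have h2 : Filter.Tendsto (fun n : ℕ => (2 : ℝ) ^ (-(n * (ε / 2)))) Filter.atTop (nhds 0) := by
      have h3 : ∀ n : ℕ, (2 : ℝ) ^ (-(n * (ε / 2))) = ((2 : ℝ) ^ (-(ε / 2))) ^ n := by
        intro n
        rw [← Real.rpow_natCast, ← Real.rpow_mul (by norm_num)]
        congr 1
        ring
      simp_rw [h3]
      exact tendsto_pow_atTop_nhds_zero_of_lt_one (by positivity)
        (Real.rpow_lt_one_of_one_lt_of_neg (by norm_num) (by linarith))
    simpa using h1.add (h2.const_mul 8)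
  obtain ⟨N, hN⟩ := Filter.eventually_atTop.1 (hlim.eventually (gt_mem_nhds hε0))
  refine ⟨N, fun n hn nA nB nC hm => ?_⟩
  obtain ⟨E, D, hED⟩ := exists_code p hp0 hp1 ![nA, nB, nC] ε hm (fun V => r V ^ n) (fun V => hr V n)
  have hN' := hN n hn
  let mk : (Fin nA → Bool) × (Fin nB → Bool) × (Fin nC → Bool) →
      ∀ i : Fin 3, Fin (![nA, nB, nC] i) → Bool := fun c i =>
    match i with
    | 0 => c.1
    | 1 => c.2.1
    | 2 => c.2.2
  let e : (Fin n → Fin 3 → Bool) ≃ (Fin n → Bool) × (Fin n → Bool) × (Fin n → Bool) :=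
    { toFun := fun x => (fun t => x t 0, fun t => x t 1, fun t => x t 2)
      invFun := fun x t => ![x.1 t, x.2.1 t, x.2.2 t]
      left_inv := by
        intro x
        ext t i
        fin_cases i <;> rfl
      right_inv := by
        intro x
        rfl }
  refine ⟨E 0, E 1, E 2, fun c => e (D (mk c)), ?_⟩
  refine le_trans (by linarith) (hED.trans (le_of_eq ?_))
  rw [sum_filter, sum_filter]
  refine Fintype.sum_equiv e _ _ fun x => ?_
  have h1 : mk (E 0 (e x).1, E 1 (e x).2.1, E 2 (e x).2.2) = enc E x := by
    funext i
    fin_cases i <;> rfl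
  have h2 : ∀ t, ![(e x).1 t, (e x).2.1 t, (e x).2.2 t] = x t := by
    intro t
    exact congrFun (e.left_inv x) t
  simp only [h1, h2, e.apply_eq_iff_eq]
end
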